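/- Let λ > 0, p > 0, q > 0, τ ∈ ℝ, −1 ≤ δ < p−1, let a ∈ A^τ_δ(ℝ), let χ ∈ S(ℝ) with χ(0) = 1, and for 0 < ε < 1 set χ_ε(x) := χ(εx) with k-th derivative χ_ε^{(k)}. Then for every integer k ≥ 1, lim_{ε→0⁺} ∫₀^∞ e^{±iλx^p} x^{q−1} a(x) χ_ε^{(k)}(x) dx = 0. -/

import Mathlib

open MeasureTheory Filter Topology Set

/-- The amplitude class `A^τ_δ(ℝ)`. -/
def AmpClass (τ δ : ℝ) (a : ℝ → ℂ) : Prop :=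
  ContDiff ℝ (⊤ : ℕ∞) a ∧ ∀ k : ℕ, ∃ C : ℝ, 0 < C ∧ ∀ x : ℝ,
    ‖iteratedDeriv k a x‖ ≤ C * (1 + x ^ 2) ^ ((τ + δ * k) / 2)

open scoped SchwartzMap

/-- `f` has, on `[1, ∞)`, symbol estimates of order `m` and type `δ` for its first `n`
derivatives. -/
def SymbolBound (δ : ℝ) : ℕ → ℝ → (ℝ → ℂ) → Prop
  | 0, m, f => ContinuousOn f (Ici 1) ∧ ∃ C, ∀ x : ℝ, 1 ≤ x → ‖f x‖ ≤ C * x ^ m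
  | n + 1, m, f => (∃ C, ∀ x : ℝ, 1 ≤ x → ‖f x‖ ≤ C * x ^ m) ∧
      ∃ f' : ℝ → ℂ, (∀ x : ℝ, 1 ≤ x → HasDerivAt f (f' x) x) ∧ SymbolBound δ n (m + δ) f'

namespace SymbolBound

variable {δ m m' : ℝ} {n : ℕ} {f g : ℝ → ℂ}

lemma bound (h : SymbolBound δ n m f) : ∃ C, ∀ x : ℝ, 1 ≤ x → ‖f x‖ ≤ C * x ^ m := by
  cases n with
  | zero => exact h.2
  | succ n => exact h.1

lemma continuousOn (h : SymbolBound δ n m f) : ContinuousOn f (Ici 1) := by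
  cases n with
  | zero => exact h.1
  | succ n =>
    obtain ⟨_, f', hf', _⟩ := h
    exact fun x hx => (hf' x hx).continuousAt.continuousWithinAt

lemma of_succ (h : SymbolBound δ (n + 1) m f) : SymbolBound δ n m f := by
  induction n generalizing m f with
  | zero => exact ⟨h.continuousOn, h.bound⟩
  | succ n ih =>
    obtain ⟨hb, f', hf', hs⟩ := h
    exact ⟨hb, f', hf', ih hs⟩

lemma mono (hm : m ≤ m') (h : SymbolBound δ n m f) : SymbolBound δ n m' f := by
  have key : ∀ {m m' : ℝ} {f : ℝ → ℂ}, m ≤ m' →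
      (∃ C, ∀ x : ℝ, 1 ≤ x → ‖f x‖ ≤ C * x ^ m) →
      ∃ C, ∀ x : ℝ, 1 ≤ x → ‖f x‖ ≤ C * x ^ m' := by
    rintro m m' f hm ⟨C, hC⟩
    refine ⟨|C|, fun x hx => (hC x hx).trans ?_⟩
    have := Real.rpow_le_rpow_of_exponent_le hx hm
    have h0 : 0 ≤ x ^ m := by positivity
    gcongr
    exact le_abs_self C
  induction n generalizing m m' f with
  | zero => exact ⟨h.1, key hm h.2⟩
  | succ n ih =>
    obtain ⟨hb, f', hf', hs⟩ := h
    exact ⟨key hm hb, f', hf', ih (by linarith) hs⟩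

lemma add (hf : SymbolBound δ n m f) (hg : SymbolBound δ n m g) :
    SymbolBound δ n m (fun x => f x + g x) := by
  have key : ∀ {m : ℝ} {f g : ℝ → ℂ},
      (∃ C, ∀ x : ℝ, 1 ≤ x → ‖f x‖ ≤ C * x ^ m) →
      (∃ C, ∀ x : ℝ, 1 ≤ x → ‖g x‖ ≤ C * x ^ m) →
      ∃ C, ∀ x : ℝ, 1 ≤ x → ‖f x + g x‖ ≤ C * x ^ m := by
    rintro m f g ⟨C, hC⟩ ⟨D, hD⟩
    refine ⟨C + D, fun x hx => (norm_add_le _ _).trans ?_⟩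
    linarith [hC x hx, hD x hx]
  induction n generalizing m f g with
  | zero => exact ⟨hf.1.add hg.1, key hf.2 hg.2⟩
  | succ n ih =>
    obtain ⟨hb, f', hf', hs⟩ := hf
    obtain ⟨hb2, g', hg', hs2⟩ := hg
    exact ⟨key hb hb2, _, fun x hx => (hf' x hx).add (hg' x hx), ih hs hs2⟩

lemma mul (hf : SymbolBound δ n m f) (hg : SymbolBound δ n m' g) :
    SymbolBound δ n (m + m') (fun x => f x * g x) := by
  have key : ∀ {m m' : ℝ} {f g : ℝ → ℂ},
      (∃ C, ∀ x : ℝ, 1 ≤ x → ‖f x‖ ≤ C * x ^ m) →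
      (∃ C, ∀ x : ℝ, 1 ≤ x → ‖g x‖ ≤ C * x ^ m') →
      ∃ C, ∀ x : ℝ, 1 ≤ x → ‖f x * g x‖ ≤ C * x ^ (m + m') := by
    rintro m m' f g ⟨C, hC⟩ ⟨D, hD⟩
    refine ⟨C * D, fun x hx => ?_⟩
    rw [norm_mul, Real.rpow_add (by linarith)]
    calc ‖f x‖ * ‖g x‖ ≤ (C * x ^ m) * (D * x ^ m') :=
          mul_le_mul (hC x hx) (hD x hx) (norm_nonneg _) ((norm_nonneg _).trans (hC x hx))
      _ = _ := by ring
  induction n generalizing m m' f g with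
  | zero => exact ⟨hf.1.mul hg.1, key hf.2 hg.2⟩
  | succ n ih =>
    have hf0 := hf.of_succ
    have hg0 := hg.of_succ
    obtain ⟨hb, f', hf', hs⟩ := hf
    obtain ⟨hb2, g', hg', hs2⟩ := hg
    refine ⟨key hb hb2, _, fun x hx => (hf' x hx).mul (hg' x hx), add ?_ ?_⟩
    · exact (ih hs hg0).mono (by linarith)
    · exact (ih hf0 hs2).mono (by linarith)

lemma const_mul_rpow (hδ : -1 ≤ δ) (n : ℕ) (c : ℂ) (b : ℝ) :
    SymbolBound δ n b (fun x => c * ((x ^ b : ℝ) : ℂ)) := by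
  have key : ∀ (c : ℂ) (b : ℝ), ∃ C, ∀ x : ℝ, 1 ≤ x → ‖c * ((x ^ b : ℝ) : ℂ)‖ ≤ C * x ^ b := by
    intro c b
    refine ⟨‖c‖, fun x hx => ?_⟩
    rw [norm_mul, Complex.norm_real, Real.norm_of_nonneg (by positivity)]
  have hd : ∀ (c : ℂ) (b x : ℝ), 1 ≤ x → HasDerivAt (fun x : ℝ => c * ((x ^ b : ℝ) : ℂ))
      (c * b * ((x ^ (b - 1) : ℝ) : ℂ)) x := by
    intro c b x hx
    have h := (Real.hasDerivAt_rpow_const (x := x) (p := b) (Or.inl (by linarith))).ofReal_comp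
    refine (h.const_mul c).congr_deriv ?_
    push_cast
    ring
  induction n generalizing c b with
  | zero => exact ⟨fun x hx => (hd c b x hx).continuousAt.continuousWithinAt, key c b⟩
  | succ n ih => exact ⟨key c b, _, hd c b, (ih (c * b) (b - 1)).mono (by linarith)⟩

end SymbolBound

lemma AmpClass.symbolBound {τ δ : ℝ} {a : ℝ → ℂ} (ha : AmpClass τ δ a) (n : ℕ) :
    SymbolBound δ n τ a := by
  have key : ∀ j : ℕ, ∃ C, ∀ x : ℝ, 1 ≤ x → ‖iteratedDeriv j a x‖ ≤ C * x ^ (τ + δ * j) := by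
    intro j
    obtain ⟨C, hC0, hC⟩ := ha.2 j
    set r := τ + δ * j with hr
    refine ⟨C * 2 ^ |r / 2|, fun x hx => (hC x).trans ?_⟩
    rw [mul_assoc]
    refine mul_le_mul_of_nonneg_left ?_ hC0.le
    have hx0 : 0 < x := by linarith
    have h1 : (1 + x ^ 2 : ℝ) = (1 + (x ^ 2)⁻¹) * x ^ 2 := by field_simp; ring
    have h2 : (x ^ 2 : ℝ) ^ (r / 2) = x ^ r := by
      rw [← Real.rpow_natCast, ← Real.rpow_mul hx0.le]
      congr 1
      push_cast
      ring
    have h3 : (x ^ 2)⁻¹ ≤ 1 := inv_le_one_of_one_le₀ (by nlinarith)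
    have h4 : 0 ≤ (x ^ 2)⁻¹ := by positivity
    rw [h1, Real.mul_rpow (by positivity) (by positivity), h2]
    refine mul_le_mul_of_nonneg_right ?_ (by positivity)
    calc (1 + (x ^ 2)⁻¹) ^ (r / 2) ≤ (1 + (x ^ 2)⁻¹) ^ |r / 2| :=
          Real.rpow_le_rpow_of_exponent_le (by linarith) (le_abs_self _)
      _ ≤ 2 ^ |r / 2| := Real.rpow_le_rpow (by linarith) (by linarith) (abs_nonneg _)
  have hc : ∀ j x, HasDerivAt (iteratedDeriv j a) (iteratedDeriv (j + 1) a x) x := by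
    intro j x
    rw [iteratedDeriv_succ]
    exact (ha.1.differentiable_iteratedDeriv j (by exact_mod_cast WithTop.coe_lt_top _)
      |>.differentiableAt).hasDerivAt
  have main : ∀ j : ℕ, SymbolBound δ n (τ + δ * j) (iteratedDeriv j a) := by
    induction n with
    | zero => exact fun j => ⟨fun x _ => (hc j x).continuousAt.continuousWithinAt, key j⟩
    | succ n ih =>
      refine fun j => ⟨key j, _, fun x _ => hc j x, ?_⟩
      refine (ih (j + 1)).mono ?_
      push_cast
      linarith
  simpa using main 0

lemma SchwartzMap.exists_norm_le (ψ : 𝓢(ℝ, ℂ)) : ∃ C, 0 ≤ C ∧ ∀ x, ‖ψ x‖ ≤ C := by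
  obtain ⟨C, hC0, hC⟩ := ψ.decay 0 0
  exact ⟨C, hC0.le, fun x => by simpa using hC x⟩

lemma norm_cexp_mul_ofReal_of_re_eq_zero {c : ℂ} (hc : c.re = 0) (t : ℝ) :
    ‖Complex.exp (c * (t : ℂ))‖ = 1 := by
  simp [Complex.norm_exp, hc]

lemma continuousOn_oscillatory {p : ℝ} (hp : 0 < p) (c : ℂ) {f : ℝ → ℂ}
    {s : Set ℝ} (hf : ContinuousOn f s) (ψ : 𝓢(ℝ, ℂ)) (ε : ℝ) :
    ContinuousOn (fun x : ℝ => Complex.exp (c * ((x ^ p : ℝ) : ℂ)) * (f x * ψ (ε * x))) s := by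
  have h1 : Continuous fun x : ℝ => x ^ p := Real.continuous_rpow_const hp.le
  have h2 : Continuous fun x : ℝ => ψ (ε * x) := ψ.continuous.comp (by fun_prop)
  have h3 : Continuous fun x : ℝ => Complex.exp (c * ((x ^ p : ℝ) : ℂ)) := by fun_prop
  exact h3.continuousOn.mul (hf.mul h2.continuousOn)

lemma SymbolBound.integrableOn {δ m p : ℝ} {n : ℕ} {f : ℝ → ℂ} (hp : 0 < p)
    {c : ℂ} (hc : c.re = 0) (hf : SymbolBound δ n m f) (ψ : 𝓢(ℝ, ℂ)) {ε : ℝ} (hε : 0 < ε) :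
    IntegrableOn (fun x : ℝ => Complex.exp (c * ((x ^ p : ℝ) : ℂ)) * (f x * ψ (ε * x)))
      (Ioi 1) := by
  obtain ⟨C, hC⟩ := hf.bound
  obtain ⟨N, hN⟩ := exists_nat_gt (m + 1)
  obtain ⟨D, hD0, hD⟩ := ψ.decay N 0
  have hint : IntegrableOn (fun x : ℝ => C * (D / ε ^ N) * x ^ (m - N)) (Ioi 1) :=
    (integrableOn_Ioi_rpow_of_lt (by linarith) one_pos).const_mul _
  refine Integrable.mono' hint
    (((continuousOn_oscillatory hp c hf.continuousOn ψ ε).mono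
      Ioi_subset_Ici_self).aestronglyMeasurable measurableSet_Ioi) ?_
  refine (ae_restrict_mem measurableSet_Ioi).mono fun x (hx : 1 < x) => ?_
  rw [norm_mul, norm_cexp_mul_ofReal_of_re_eq_zero hc, one_mul, norm_mul]
  have hx0 : 0 < x := by linarith
  have h1 : ‖ψ (ε * x)‖ ≤ D / (ε * x) ^ N := by
    have := hD (ε * x)
    rw [norm_iteratedFDeriv_zero, Real.norm_of_nonneg (by positivity)] at this
    rw [le_div_iff₀ (by positivity)]
    linarith
  calc ‖f x‖ * ‖ψ (ε * x)‖ ≤ (C * x ^ m) * (D / (ε * x) ^ N) :=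
        mul_le_mul (hC x hx.le) h1 (norm_nonneg _) ((norm_nonneg _).trans (hC x hx.le))
    _ = _ := by
        rw [Real.rpow_sub hx0, Real.rpow_natCast, mul_pow]
        field_simp

/-- Repeated integration by parts bounds the oscillatory integrals over `[1, ∞)` uniformly in the
scale of the convergence factor. -/
lemma SymbolBound.exists_norm_integral_le {δ p : ℝ} (hp : 0 < p) (hδ : -1 ≤ δ)
    {c : ℂ} (hc : c.re = 0) (hc0 : c ≠ 0) {n : ℕ} {m : ℝ} {f : ℝ → ℂ}
    (hf : SymbolBound δ n m f) (hm : m + n * (δ - (p - 1)) < -1) (ψ : 𝓢(ℝ, ℂ)) :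
    ∃ B, ∀ ε : ℝ, 0 < ε →
      ‖∫ x in Ioi (1 : ℝ), Complex.exp (c * ((x ^ p : ℝ) : ℂ)) * (f x * ψ (ε * x))‖ ≤ B := by
  induction n generalizing m f ψ with
  | zero =>
    obtain ⟨C, hC⟩ := hf.bound
    obtain ⟨D, hD0, hD⟩ := ψ.exists_norm_le
    have hm' : m < -1 := by simpa using hm
    refine ⟨∫ x in Ioi (1 : ℝ), C * D * x ^ m, fun ε hε => ?_⟩
    refine norm_integral_le_of_norm_le
      ((integrableOn_Ioi_rpow_of_lt hm' one_pos).const_mul _) ?_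
    refine (ae_restrict_mem measurableSet_Ioi).mono fun x (hx : 1 < x) => ?_
    rw [norm_mul, norm_cexp_mul_ofReal_of_re_eq_zero hc, one_mul, norm_mul]
    calc ‖f x‖ * ‖ψ (ε * x)‖ ≤ (C * x ^ m) * D :=
          mul_le_mul (hC x hx.le) (hD _) (norm_nonneg _) ((norm_nonneg _).trans (hC x hx.le))
      _ = _ := by ring
  | succ n ih =>
    set g : ℝ → ℂ := fun x => f x * ((c * p)⁻¹ * ((x ^ (1 - p) : ℝ) : ℂ)) with hg
    have hgS : SymbolBound δ (n + 1) (m + (1 - p)) g := hf.mul (const_mul_rpow hδ _ _ _)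
    have hhS : SymbolBound δ n (m + (1 - p) + δ) (fun x => g x * (1 * ((x ^ (-1 : ℝ) : ℝ) : ℂ))) :=
      (hgS.of_succ.mul (const_mul_rpow hδ _ 1 (-1))).mono (by linarith)
    obtain ⟨-, g', hg', hg'S⟩ := id hgS
    have hidt : Function.HasTemperateGrowth (fun x : ℝ => (x : ℂ)) := by fun_prop
    set φ : 𝓢(ℝ, ℂ) :=
      SchwartzMap.smulLeftCLM ℂ (fun x : ℝ => (x : ℂ)) (SchwartzMap.derivCLM ℂ ℂ ψ) with hφ
    have hφ_apply : ∀ y, φ y = y * deriv ψ y := by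
      intro y
      rw [hφ, SchwartzMap.smulLeftCLM_apply_apply hidt]
      rfl
    have hm' : m + (1 - p) + δ + n * (δ - (p - 1)) < -1 := by
      push_cast at hm
      linarith
    obtain ⟨B₁, hB₁⟩ := ih hg'S hm' ψ
    obtain ⟨B₂, hB₂⟩ := ih hhS hm' φ
    obtain ⟨D, hD0, hD⟩ := ψ.exists_norm_le
    refine ⟨‖g 1‖ * D + B₁ + B₂, fun ε hε => ?_⟩
    have i0 := hf.integrableOn hp hc ψ hε
    have i1 := hg'S.integrableOn hp hc ψ hε
    have i2 := hhS.integrableOn hp hc φ hε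
    have iF := hgS.integrableOn hp hc ψ hε
    have hderiv : ∀ x ∈ Ici (1 : ℝ),
        HasDerivAt (fun x : ℝ => Complex.exp (c * ((x ^ p : ℝ) : ℂ)) * (g x * ψ (ε * x)))
          (Complex.exp (c * ((x ^ p : ℝ) : ℂ)) * (f x * ψ (ε * x)) +
            Complex.exp (c * ((x ^ p : ℝ) : ℂ)) * (g' x * ψ (ε * x)) +
            Complex.exp (c * ((x ^ p : ℝ) : ℂ)) *
              (g x * (1 * ((x ^ (-1 : ℝ) : ℝ) : ℂ)) * φ (ε * x))) x := by
      intro x hx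
      have hx0 : 0 < x := one_pos.trans_le hx
      have d1 : HasDerivAt (fun x : ℝ => Complex.exp (c * ((x ^ p : ℝ) : ℂ))) _ x :=
        ((Real.hasDerivAt_rpow_const (x := x) (p := p)
          (Or.inl hx0.ne')).ofReal_comp.const_mul c).cexp
      have d2 : HasDerivAt (fun x : ℝ => ψ (ε * x)) (ε • deriv ψ (ε * x)) x := by
        have := (ψ.hasDerivAt (ε * x)).scomp x ((hasDerivAt_id x).const_mul ε)
        simpa [Function.comp_def] using this
      refine (d1.mul ((hg' x hx).mul d2)).congr_deriv ?_
      have hw : ((x ^ (1 - p) : ℝ) : ℂ) * ((x ^ (p - 1) : ℝ) : ℂ) = 1 := by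
        rw [← Complex.ofReal_mul, ← Real.rpow_add hx0]
        simp
      have hp0 : (p : ℂ) ≠ 0 := by exact_mod_cast hp.ne'
      have hgf : g x * (c * (p * ((x ^ (p - 1) : ℝ) : ℂ))) = f x := by
        calc _ = f x * ((c * p)⁻¹ * (c * p)) *
              (((x ^ (1 - p) : ℝ) : ℂ) * ((x ^ (p - 1) : ℝ) : ℂ)) := by rw [hg]; ring
          _ = f x := by rw [hw, inv_mul_cancel₀ (mul_ne_zero hc0 hp0)]; ring
      have hxi : ((x ^ (-1 : ℝ) : ℝ) : ℂ) * x = 1 := by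
        rw [Real.rpow_neg_one, ← Complex.ofReal_mul, inv_mul_cancel₀ hx0.ne']
        simp
      rw [hφ_apply, Complex.real_smul, ← hgf]
      simp only [Pi.mul_apply]
      push_cast
      linear_combination -Complex.exp (c * ((x ^ p : ℝ) : ℂ)) * g x * ε * deriv ψ (ε * x) * hxi
    have hlim := tendsto_zero_of_hasDerivAt_of_integrableOn_Ioi
      (fun x hx => hderiv x (Ioi_subset_Ici_self hx)) ((i0.add i1).add i2) iF
    have hI := integral_Ioi_of_hasDerivAt_of_tendsto' hderiv ((i0.add i1).add i2) hlim
    have hI' := (integral_add (i0.add i1) i2).symm.trans hI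
    rw [integral_add' i0 i1] at hI'
    have hb : ‖Complex.exp (c * (((1 : ℝ) ^ p : ℝ) : ℂ)) * (g 1 * ψ (ε * 1))‖ ≤ ‖g 1‖ * D := by
      rw [norm_mul, norm_cexp_mul_ofReal_of_re_eq_zero hc, one_mul, norm_mul]
      exact mul_le_mul_of_nonneg_left (hD _) (norm_nonneg _)
    have hsolve : ∀ {u v w z : ℂ}, u + v + w = 0 - z → ‖u‖ ≤ ‖z‖ + ‖v‖ + ‖w‖ := by
      intro u v w z h
      have : u = -(z + v + w) := by linear_combination h
      rw [this, norm_neg]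
      exact norm_add₃_le
    exact (hsolve hI').trans (add_le_add (add_le_add hb (hB₁ ε hε)) (hB₂ ε hε))

lemma SchwartzMap.exists_coe_eq_iteratedDeriv (χ : 𝓢(ℝ, ℂ)) (k : ℕ) :
    ∃ ψ : 𝓢(ℝ, ℂ), ⇑ψ = iteratedDeriv k χ := by
  induction k with
  | zero => exact ⟨χ, by simp⟩
  | succ k ih =>
    obtain ⟨ψ, hψ⟩ := ih
    refine ⟨SchwartzMap.derivCLM ℂ ℂ ψ, ?_⟩
    rw [iteratedDeriv_succ, ← hψ]
    rfl

lemma integrableOn_Ioc_oscillatory {p q : ℝ} (hp : 0 < p) (hq : 0 < q) (c : ℂ) {a : ℝ → ℂ}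
    (ha : Continuous a) (ψ : 𝓢(ℝ, ℂ)) (ε : ℝ) :
    IntegrableOn (fun x : ℝ => Complex.exp (c * ((x ^ p : ℝ) : ℂ)) *
      (((x ^ (q - 1) : ℝ) : ℂ) * a x * ψ (ε * x))) (Ioc 0 1) := by
  have hr : IntervalIntegrable (fun x : ℝ => x ^ (q - 1)) volume 0 1 :=
    intervalIntegral.intervalIntegrable_rpow' (by linarith)
  have h0 : IntervalIntegrable (fun x : ℝ => ((x ^ (q - 1) : ℝ) : ℂ)) volume 0 1 :=
    ⟨hr.1.ofReal, hr.2.ofReal⟩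
  have h1 := h0.mul_continuousOn
    (continuousOn_oscillatory hp c ha.continuousOn ψ ε)
  rw [intervalIntegrable_iff_integrableOn_Ioc_of_le zero_le_one] at h1
  refine h1.congr_fun (fun x _ => ?_) measurableSet_Ioc
  ring

lemma exists_norm_integral_Ioc_oscillatory_le {p q : ℝ} (hq : 0 < q)
    {c : ℂ} (hc : c.re = 0) {a : ℝ → ℂ} (ha : Continuous a) (ψ : 𝓢(ℝ, ℂ)) :
    ∃ B, ∀ ε : ℝ, ‖∫ x in Ioc (0 : ℝ) 1, Complex.exp (c * ((x ^ p : ℝ) : ℂ)) *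
      (((x ^ (q - 1) : ℝ) : ℂ) * a x * ψ (ε * x))‖ ≤ B := by
  obtain ⟨D, hD0, hD⟩ := ψ.exists_norm_le
  have h0 : IntervalIntegrable (fun x : ℝ => x ^ (q - 1)) volume 0 1 :=
    intervalIntegral.intervalIntegrable_rpow' (by linarith)
  have h1 := (h0.mul_continuousOn ha.norm.continuousOn).mul_const D
  rw [intervalIntegrable_iff_integrableOn_Ioc_of_le zero_le_one] at h1
  refine ⟨∫ x in Ioc (0 : ℝ) 1, x ^ (q - 1) * ‖a x‖ * D, fun ε => ?_⟩
  refine norm_integral_le_of_norm_le h1 ?_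
  refine (ae_restrict_mem measurableSet_Ioc).mono fun x hx => ?_
  have hx0 : 0 < x := hx.1
  rw [norm_mul, norm_cexp_mul_ofReal_of_re_eq_zero hc, one_mul, norm_mul, norm_mul,
    Complex.norm_real, Real.norm_of_nonneg (by positivity)]
  exact mul_le_mul_of_nonneg_left (hD _) (by positivity)

/-- **Vanishing of the contributions of derivatives of the convergence factor**
(double signs in the same order, encoded by `s = ±1`): for every `k ≥ 1`, the integrals
`∫₀^∞ e^{±iλx^p} x^{q-1} a(x) χ_ε^{(k)}(x) dx` are absolutely convergent for `0 < ε < 1`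
and tend to `0` as `ε → 0⁺`. -/
theorem oscillatory_chi_deriv_vanish (lam p q τ δ : ℝ) (hlam : 0 < lam) (hp : 0 < p)
    (hq : 0 < q) (hδ₁ : -1 ≤ δ) (hδ₂ : δ < p - 1) (a : ℝ → ℂ) (ha : AmpClass τ δ a)
    (χ : SchwartzMap ℝ ℂ) (hχ : χ 0 = 1) (s : ℝ) (hs : s = 1 ∨ s = -1)
    (k : ℕ) (hk : 1 ≤ k) :
    (∀ ε : ℝ, 0 < ε → ε < 1 →
      IntegrableOn
        (fun x : ℝ => Complex.exp (s * Complex.I * lam * ((x ^ p : ℝ) : ℂ)) *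
          (((x ^ (q - 1) : ℝ) : ℂ) * a x * iteratedDeriv k (fun z => χ (ε * z)) x))
        (Set.Ioi 0)) ∧
    Tendsto
      (fun ε : ℝ => ∫ x in Set.Ioi (0 : ℝ),
        Complex.exp (s * Complex.I * lam * ((x ^ p : ℝ) : ℂ)) *
          (((x ^ (q - 1) : ℝ) : ℂ) * a x * iteratedDeriv k (fun z => χ (ε * z)) x))
      (𝓝[>] (0 : ℝ)) (𝓝 0) := by
  set c : ℂ := s * Complex.I * lam with hc
  have hs0 : s ≠ 0 := by rcases hs with rfl | rfl <;> norm_num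
  have hcre : c.re = 0 := by simp [hc]
  have hc0 : c ≠ 0 := by simp [hc, hs0, hlam.ne']
  obtain ⟨ψ, hψ⟩ := χ.exists_coe_eq_iteratedDeriv k
  set J : ℝ → ℝ → ℂ := fun ε x => Complex.exp (c * ((x ^ p : ℝ) : ℂ)) *
    (((x ^ (q - 1) : ℝ) : ℂ) * a x * ψ (ε * x)) with hJ
  have hscale : ∀ ε x : ℝ, Complex.exp (c * ((x ^ p : ℝ) : ℂ)) *
      (((x ^ (q - 1) : ℝ) : ℂ) * a x * iteratedDeriv k (fun z => χ (ε * z)) x) =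
      (ε ^ k : ℝ) * J ε x := by
    intro ε x
    have := congrFun (iteratedDeriv_comp_const_smul (n := k) (χ.smooth k) ε) x
    rw [this, ← hψ, Complex.real_smul, hJ]
    ring
  simp only [hscale]
  have hS : ∀ n, SymbolBound δ n (q - 1 + τ) (fun x => ((x ^ (q - 1) : ℝ) : ℂ) * a x) := by
    intro n
    simpa using (SymbolBound.const_mul_rpow hδ₁ n 1 (q - 1)).mul (ha.symbolBound n)
  have hac : Continuous a := ha.1.continuous
  have hsplit : Ioc (0 : ℝ) 1 ∪ Ioi 1 = Ioi 0 := Ioc_union_Ioi_eq_Ioi zero_le_one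
  have hi₁ : ∀ ε, IntegrableOn (J ε) (Ioc 0 1) := fun ε =>
    integrableOn_Ioc_oscillatory hp hq c hac ψ ε
  have hi₂ : ∀ ε, 0 < ε → IntegrableOn (J ε) (Ioi 1) := fun ε hε =>
    (hS 0).integrableOn hp hcre ψ hε
  constructor
  · intro ε hε _
    have := (hi₁ ε).union (hi₂ ε hε)
    rw [hsplit] at this
    exact this.const_mul _
  · obtain ⟨n, hn⟩ := exists_nat_gt ((q - 1 + τ + 1) / (p - 1 - δ))
    rw [div_lt_iff₀ (by linarith)] at hn
    obtain ⟨B₁, hB₁⟩ := exists_norm_integral_Ioc_oscillatory_le (p := p) hq hcre hac ψ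
    obtain ⟨B₂, hB₂⟩ := (hS n).exists_norm_integral_le hp hδ₁ hcre hc0 (by linarith) ψ
    have hlim : Tendsto (fun ε : ℝ => ε ^ k * (B₁ + B₂)) (𝓝[>] 0) (𝓝 0) := by
      have : Continuous fun ε : ℝ => ε ^ k * (B₁ + B₂) := by fun_prop
      have h := (this.tendsto 0).mono_left (nhdsWithin_le_nhds (s := Ioi 0))
      simpa [zero_pow (Nat.one_le_iff_ne_zero.mp hk)] using h
    refine squeeze_zero_norm' ?_ hlim
    filter_upwards [self_mem_nhdsWithin] with ε (hε : 0 < ε)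
    rw [integral_const_mul, norm_mul, Complex.norm_real, Real.norm_of_nonneg (by positivity),
      ← hsplit, setIntegral_union (Ioc_disjoint_Ioi le_rfl) measurableSet_Ioi (hi₁ ε) (hi₂ ε hε)]
    refine mul_le_mul_of_nonneg_left ?_ (by positivity)
    exact (norm_add_le _ _).trans (add_le_add (hB₁ ε) (hB₂ ε hε))
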